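/- For every n with 3 ≤ n ≤ 8, the minimum size S(n) of a p-encoding with n input variables equals 3n − 6. -/

import Mathlib

/-- A literal is a variable together with a polarity (`true` = positive). -/
abbrev Lit (V : Type) := V × Bool

/-- The negation of a literal. -/
def negLit {V : Type} (l : Lit V) : Lit V := (l.1, !l.2)

/-- A clause is a finite set of literals. -/
abbrev Clause (V : Type) := Finset (Lit V)

/-- A CNF formula is a finite set of clauses. -/
abbrev CNF (V : Type) := Finset (Clause V)

/-- A clause proper contains no complementary pair of literals. -/
def IsClause {V : Type} [DecidableEq V] (C : Clause V) : Prop := ∀ l ∈ C, negLit l ∉ C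

instance {V : Type} [DecidableEq V] (C : Clause V) : Decidable (IsClause C) := by
  unfold IsClause; infer_instance

/-- A CNF formula proper consists of proper clauses. -/
def IsCNF {V : Type} [DecidableEq V] (φ : CNF V) : Prop := ∀ C ∈ φ, IsClause C

/-- Satisfaction of a literal by an assignment. -/
def LitSat {V : Type} (α : V → Bool) (l : Lit V) : Prop := α l.1 = l.2

/-- Satisfaction of a clause by an assignment. -/
def ClauseSat {V : Type} (α : V → Bool) (C : Clause V) : Prop := ∃ l ∈ C, LitSat α l

/-- Satisfaction of a CNF formula by an assignment. -/
def CnfSat {V : Type} (α : V → Bool) (φ : CNF V) : Prop := ∀ C ∈ φ, ClauseSat α C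

/-- `UnitDerives φ C` : the clause `C` can be derived from `φ` by a series of unit
resolutions (each step resolves a derived unit clause with another derived clause). -/
inductive UnitDerives {V : Type} [DecidableEq V] (φ : CNF V) : Clause V → Prop
  | base {C : Clause V} (h : C ∈ φ) : UnitDerives φ C
  | step {l : Lit V} {C : Clause V} (h1 : UnitDerives φ {l})
      (h2 : UnitDerives φ C) (h3 : negLit l ∈ C) :
      UnitDerives φ (C.erase (negLit l))

/-- The formula `φ ∧ l` (adding a unit clause). -/
def addUnit {V : Type} [DecidableEq V] (φ : CNF V) (l : Lit V) : CNF V :=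
  insert {l} φ

/-- The formula `φ ∧ g₁ ∧ … ∧ g_p` (adding finitely many unit clauses). -/
def addUnits {V : Type} [DecidableEq V] (φ : CNF V) (L : Finset (Lit V)) : CNF V :=
  φ ∪ L.image (fun l => ({l} : Clause V))

/-- Variables: `n` input variables and `ℓ` auxiliary variables. -/
abbrev Var (n ℓ : ℕ) : Type := Sum (Fin n) (Fin ℓ)

/-- The literal on the `i`-th input variable with polarity `b`. -/
def inLit {n ℓ : ℕ} (i : Fin n) (b : Bool) : Lit (Var n ℓ) := (Sum.inl i, b)

/-- A p-encoding: (P1) `φ ∧ x_i` is satisfiable for each input variable `x_i`, and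
(P2) `φ ∧ x_i ⊢₁ ¬x_j` for all `i ≠ j`. -/
def IsPEncoding {n ℓ : ℕ} (φ : CNF (Var n ℓ)) : Prop :=
  IsCNF φ ∧
  (∀ i : Fin n, ∃ α : Var n ℓ → Bool, CnfSat α φ ∧ α (Sum.inl i) = true) ∧
  (∀ i j : Fin n, i ≠ j →
    UnitDerives (addUnit φ (inLit i true)) {inLit j false})

/-- A p-encoding relative to a set `I` of input indices. -/
def IsPEncodingOn {n ℓ : ℕ} (φ : CNF (Var n ℓ)) (I : Finset (Fin n)) : Prop :=
  IsCNF φ ∧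
  (∀ i ∈ I, ∃ α : Var n ℓ → Bool, CnfSat α φ ∧ α (Sum.inl i) = true) ∧
  (∀ i ∈ I, ∀ j ∈ I, i ≠ j →
    UnitDerives (addUnit φ (inLit i true)) {inLit j false})

/-- 2-CNF: every clause has at most two literals. -/
def Is2CNF {V : Type} (φ : CNF V) : Prop := ∀ C ∈ φ, C.card ≤ 2

/-- The set of possible sizes of p-encodings with `n` input variables. -/
def pencSizes (n : ℕ) : Set ℕ :=
  {k | ∃ ℓ : ℕ, ∃ φ : CNF (Var n ℓ), IsPEncoding φ ∧ φ.card = k}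

/-- `S n` : the minimum size of a p-encoding with `n` input variables. -/
noncomputable def S (n : ℕ) : ℕ := sInf (pencSizes n)

/-- The set of possible sizes of 2-CNF p-encodings with `n` input variables. -/
def penc2Sizes (n : ℕ) : Set ℕ :=
  {k | ∃ ℓ : ℕ, ∃ φ : CNF (Var n ℓ), IsPEncoding φ ∧ Is2CNF φ ∧ φ.card = k}

/-- `S₂ n` : the minimum size of a 2-CNF p-encoding with `n` input variables. -/
noncomputable def S2 (n : ℕ) : ℕ := sInf (penc2Sizes n)

/-- `φ(x,y)` is an encoding of the boolean function `f(x)`. -/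
def Encodes {n ℓ : ℕ} (φ : CNF (Var n ℓ)) (f : (Fin n → Bool) → Prop) : Prop :=
  IsCNF φ ∧
  ∀ α : Fin n → Bool, f α ↔ ∃ β : Fin ℓ → Bool, CnfSat (Sum.elim α β) φ

/-- Injection of literals on input variables into literals of the encoding. -/
def inLits {n ℓ : ℕ} (G : Finset (Lit (Fin n))) : Finset (Lit (Var n ℓ)) :=
  G.image (fun g => ((Sum.inl g.1 : Var n ℓ), g.2))

/-- Propagation complete encoding of `f`: an encoding such that whenever
`f ∧ g₁ ∧ … ∧ g_p ⊨ h` for literals on input variables (`p ≥ 1`), unit propagation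
from `φ ∧ g₁ ∧ … ∧ g_p` derives `h` or derives the empty clause. -/
def IsPCEncoding {n ℓ : ℕ} (φ : CNF (Var n ℓ)) (f : (Fin n → Bool) → Prop) : Prop :=
  Encodes φ f ∧
  ∀ G : Finset (Lit (Fin n)), G.Nonempty → ∀ h : Lit (Fin n),
    (∀ α : Fin n → Bool, f α → (∀ g ∈ G, α g.1 = g.2) → α h.1 = h.2) →
    (UnitDerives (addUnits φ (inLits G)) {((Sum.inl h.1 : Var n ℓ), h.2)} ∨
     UnitDerives (addUnits φ (inLits G)) (∅ : Clause (Var n ℓ)))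

/-- The "at most one" function. -/
def AMO (n : ℕ) (α : Fin n → Bool) : Prop :=
  (Finset.univ.filter fun i => α i = true).card ≤ 1

/-- The "exactly one" function. -/
def EXO (n : ℕ) (α : Fin n → Bool) : Prop :=
  (Finset.univ.filter fun i => α i = true).card = 1

/-- `Qset φ i` : the set of clauses of `φ` containing the literal `¬x_i`. -/
def Qset {n ℓ : ℕ} (φ : CNF (Var n ℓ)) (i : Fin n) : CNF (Var n ℓ) :=
  φ.filter (fun C => inLit i false ∈ C)

/-- Regular form: for each `i`, `|Q_i| = 2`, clauses of `Q_i` contain no input variables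
other than `x_i`, and all clauses of `Q_i` are binary. -/
def RegularForm {n ℓ : ℕ} (φ : CNF (Var n ℓ)) : Prop :=
  ∀ i : Fin n,
    (Qset φ i).card = 2 ∧
    (∀ C ∈ Qset φ i, ∀ j : Fin n, ∀ b : Bool, ((Sum.inl j : Var n ℓ), b) ∈ C → j = i) ∧
    (∀ C ∈ Qset φ i, C.card = 2)

/-- `C` is an implicate of `φ`. -/
def Implicate {V : Type} (φ : CNF V) (C : Clause V) : Prop :=
  ∀ α : V → Bool, CnfSat α φ → ClauseSat α C

/-- `C` is a prime implicate of `φ`. -/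
def PrimeImplicate {V : Type} (φ : CNF V) (C : Clause V) : Prop :=
  Implicate φ C ∧ ∀ C' : Clause V, C' ⊂ C → ¬ Implicate φ C'

/-- `φ` is prime: every clause of `φ` is a prime implicate of `φ`. -/
def IsPrime {V : Type} (φ : CNF V) : Prop := ∀ C ∈ φ, PrimeImplicate φ C

/-- The set of clauses of `φ` in which the auxiliary variable `y` occurs
(as a positive or negative literal). -/
def occursIn {n ℓ : ℕ} (φ : CNF (Var n ℓ)) (y : Fin ℓ) : CNF (Var n ℓ) :=
  φ.filter (fun C => ((Sum.inr y : Var n ℓ), true) ∈ C ∨ ((Sum.inr y : Var n ℓ), false) ∈ C)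

/-- The substitution `g₁ ← g₂` on a literal: `g₁ ↦ g₂`, `¬g₁ ↦ ¬g₂`,
all other literals unchanged. -/
def substLit {V : Type} [DecidableEq V] (g₁ g₂ : Lit V) (l : Lit V) : Lit V :=
  if l.1 = g₁.1 then (if l.2 = g₁.2 then g₂ else negLit g₂) else l

/-- The substitution `g₁ ← g₂` applied to a clause. -/
def substClause {V : Type} [DecidableEq V] (g₁ g₂ : Lit V) (C : Clause V) : Clause V :=
  C.image (substLit g₁ g₂)

/-- The formula `φ[g₁ ← g₂]`: apply the substitution to every clause and remove the
clauses that became tautological (i.e. contain a complementary pair of literals). -/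
def substCNF {V : Type} [DecidableEq V] (g₁ g₂ : Lit V) (φ : CNF V) : CNF V :=
  (φ.image (substClause g₁ g₂)).filter (fun C => IsClause C)

/-- `restrict φ ρ` : the formula `φ(ρ)` obtained from `φ` by the partial assignment
given by the set of literals `ρ` (clauses satisfied by `ρ` are removed, and falsified
literals are removed from the remaining clauses). -/
def restrict {V : Type} [DecidableEq V] (φ : CNF V) (ρ : Finset (Lit V)) : CNF V :=
  (φ.filter (fun C => ∀ l ∈ ρ, l ∉ C)).image (fun C => C.filter (fun l => negLit l ∉ ρ))

/-- The literals derivable from `φ` by unit propagation. -/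
inductive Propagates {V : Type} (φ : CNF V) : Lit V → Prop
  | intro {C : Clause V} {l : Lit V} (hC : C ∈ φ) (hl : l ∈ C)
      (h : ∀ l' ∈ C, l' ≠ l → Propagates φ (negLit l')) : Propagates φ l

section Propagation

variable {V W : Type}

@[simp] lemma negLit_negLit (l : Lit V) : negLit (negLit l) = l := by
  simp [negLit]

lemma litSat_negLit {α : V → Bool} {l : Lit V} : LitSat α (negLit l) ↔ ¬ LitSat α l := by
  unfold LitSat negLit
  cases α l.1 <;> cases l.2 <;> simp

lemma Propagates.of_singleton {φ : CNF V} {l : Lit V} (h : {l} ∈ φ) : Propagates φ l :=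
  .intro h (Finset.mem_singleton_self l) fun _ hm hml => absurd (Finset.mem_singleton.1 hm) hml

variable [DecidableEq V] [DecidableEq W]

lemma UnitDerives.exists_superset {φ : CNF V} {C : Clause V} (h : UnitDerives φ C) :
    ∃ D ∈ φ, C ⊆ D ∧ ∀ l ∈ D, l ∉ C → Propagates φ (negLit l) := by
  induction h with
  | base h => exact ⟨_, h, subset_rfl, fun l h1 h2 => absurd h1 h2⟩
  | @step l C h1 h2 h3 ih1 ih2 =>
    obtain ⟨D1, hD1, hs1, hp1⟩ := ih1
    obtain ⟨D2, hD2, hs2, hp2⟩ := ih2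
    refine ⟨D2, hD2, (Finset.erase_subset _ _).trans hs2, fun k hk hk' => ?_⟩
    by_cases hkC : k ∈ C
    · have hkl : k = negLit l := by
        by_contra hne
        exact hk' (Finset.mem_erase.2 ⟨hne, hkC⟩)
      subst hkl
      rw [negLit_negLit]
      exact .intro hD1 (hs1 (Finset.mem_singleton_self l)) fun m hm hml =>
        hp1 m hm (by simpa using hml)
    · exact hp2 k hk hkC

lemma UnitDerives.propagates {φ : CNF V} {l : Lit V} (h : UnitDerives φ {l}) :
    Propagates φ l := by
  obtain ⟨D, hD, hs, hp⟩ := h.exists_superset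
  exact .intro hD (hs (Finset.mem_singleton_self l)) fun m hm hml => hp m hm (by simpa using hml)

lemma UnitDerives.sdiff {φ : CNF V} {C : Clause V} (hC : UnitDerives φ C) (T : Finset (Lit V))
    (hT : ∀ l ∈ T, UnitDerives φ {negLit l}) : UnitDerives φ (C \ T) := by
  induction T using Finset.induction_on with
  | empty => simpa using hC
  | insert a T ha ih =>
    have ih' := ih fun l hl => hT l (Finset.mem_insert_of_mem hl)
    rw [Finset.sdiff_insert]
    by_cases haC : a ∈ C \ T
    · have := UnitDerives.step (hT a (Finset.mem_insert_self _ _)) ih' (by simpa using haC)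
      simpa using this
    · rwa [Finset.erase_eq_of_notMem haC]

lemma Propagates.unitDerives {φ : CNF V} {l : Lit V} (h : Propagates φ l) :
    UnitDerives φ {l} := by
  induction h with
  | @intro C l hC hl h ih =>
    have := (UnitDerives.base hC).sdiff (C.erase l) fun m hm =>
      ih m (Finset.mem_of_mem_erase hm) (Finset.ne_of_mem_erase hm)
    rwa [Finset.sdiff_erase_self hl] at this

lemma Propagates.litSat {φ : CNF V} {l : Lit V} (h : Propagates φ l) {α : V → Bool}
    (hα : CnfSat α φ) : LitSat α l := by
  induction h with
  | @intro C l hC hl h ih =>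
    obtain ⟨m, hm, hmα⟩ := hα C hC
    by_cases hml : m = l
    · exact hml ▸ hmα
    · exact absurd hmα (litSat_negLit.1 (ih m hm hml))

lemma Propagates.of_pair {φ : CNF V} {a b : Lit V} (h : {a, b} ∈ φ)
    (ha : Propagates φ (negLit a)) : Propagates φ b := by
  refine .intro h (by simp) fun m hm hmb => ?_
  rcases Finset.mem_insert.1 hm with rfl | hm
  · exact ha
  · exact absurd (Finset.mem_singleton.1 hm) hmb

/-- Unit propagation is preserved by a literal map into a satisfiable formula. -/
lemma Propagates.map {φ : CNF V} {ψ : CNF W} {σ : Lit V → Lit W}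
    (hσ : ∀ l, σ (negLit l) = negLit (σ l)) {β : W → Bool} (hβ : CnfSat β ψ)
    (h : ∀ C ∈ φ, IsClause (C.image σ) → C.image σ ∈ ψ ∨ ∃ v, C = {v} ∧ Propagates ψ (σ v))
    {l : Lit V} (hl : Propagates φ l) : Propagates ψ (σ l) := by
  induction hl with
  | @intro C l hC hlC _ ih =>
    by_cases hcl : IsClause (C.image σ)
    · rcases h C hC hcl with hψ | ⟨v, rfl, hv⟩
      · refine .intro hψ (Finset.mem_image_of_mem σ hlC) fun m hm hml => ?_
        obtain ⟨k, hk, rfl⟩ := Finset.mem_image.1 hm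
        rw [← hσ]
        exact ih k hk fun hkl => hml (hkl ▸ rfl)
      · exact Finset.mem_singleton.1 hlC ▸ hv
    · simp only [IsClause, not_forall, not_not] at hcl
      obtain ⟨p, hp, hp'⟩ := hcl
      obtain ⟨a, ha, rfl⟩ := Finset.mem_image.1 hp
      obtain ⟨b, hb, hab⟩ := Finset.mem_image.1 hp'
      by_cases hal : a = l
      · subst hal
        by_cases hba : b = a
        · subst hba
          have := congrArg Prod.snd hab
          simp [negLit] at this
        · have := ih b hb hba
          rwa [hσ, hab, negLit_negLit] at this
      · have h1 := ih a ha hal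
        rw [hσ, ← hab] at h1
        by_cases hbl : b = l
        · exact hbl ▸ h1
        · have h2 := ih b hb hbl
          rw [hσ] at h2
          exact absurd (h1.litSat hβ) (litSat_negLit.1 (h2.litSat hβ))

end Propagation

/-- A p-encoding over arbitrary variables, with set of input variables `I`. -/
def IsPEnc {V : Type} [DecidableEq V] (φ : CNF V) (I : Finset V) : Prop :=
  IsCNF φ ∧ (∀ i ∈ I, ∃ α : V → Bool, CnfSat α φ ∧ α i = true) ∧
    ∀ i ∈ I, ∀ j ∈ I, i ≠ j → Propagates (addUnit φ (i, true)) (j, false)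

section Bounds

variable {V : Type} [DecidableEq V] {φ : CNF V} {I : Finset V}

lemma cnfSat_addUnit {α : V → Bool} {l : Lit V} :
    CnfSat α (addUnit φ l) ↔ LitSat α l ∧ CnfSat α φ := by
  simp only [CnfSat, addUnit, Finset.forall_mem_insert, ClauseSat, Finset.mem_singleton,
    exists_eq_left]

lemma IsPEnc.eq_false (h : IsPEnc φ I) {i j : V} (hi : i ∈ I) (hj : j ∈ I) (hij : i ≠ j)
    {α : V → Bool} (hα : CnfSat α φ) (hαi : α i = true) : α j = false :=
  (h.2.2 i hi j hj hij).litSat (cnfSat_addUnit.2 ⟨hαi, hα⟩)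

/-- The clauses of `φ` containing the negation of `i`. -/
def negOcc (φ : CNF V) (i : V) : CNF V := φ.filter fun C => (i, false) ∈ C

lemma mem_negOcc {i : V} {C : Clause V} : C ∈ negOcc φ i ↔ C ∈ φ ∧ (i, false) ∈ C := by
  simp [negOcc]

/-- Setting the variable `i` to false. -/
def setFalse (φ : CNF V) (i : V) : CNF V :=
  (φ \ negOcc φ i).image fun C => C.erase (i, true)

lemma IsPEnc.setFalse (h : IsPEnc φ I) {i : V} (hi : i ∈ I) :
    IsPEnc (setFalse φ i) (I.erase i) := by
  have hsat : ∀ k ∈ I.erase i, ∀ α : V → Bool, CnfSat α φ → α k = true →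
      CnfSat α (_root_.setFalse φ i) := by
    intro k hk α hα hαk C hC
    obtain ⟨D, hD, rfl⟩ := Finset.mem_image.1 hC
    obtain ⟨l, hl, hαl⟩ := hα D (Finset.mem_sdiff.1 hD).1
    have := h.eq_false (Finset.mem_of_mem_erase hk) hi (Finset.ne_of_mem_erase hk) hα hαk
    refine ⟨l, Finset.mem_erase.2 ⟨?_, hl⟩, hαl⟩
    rintro rfl
    simp [LitSat, this] at hαl
  refine ⟨?_, ?_, ?_⟩
  · intro C hC l hl hl'
    obtain ⟨D, hD, rfl⟩ := Finset.mem_image.1 hC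
    exact h.1 D (Finset.mem_sdiff.1 hD).1 l (Finset.mem_of_mem_erase hl)
      (Finset.mem_of_mem_erase hl')
  · intro k hk
    obtain ⟨α, hα, hαk⟩ := h.2.1 k (Finset.mem_of_mem_erase hk)
    exact ⟨α, hsat k hk α hα hαk, hαk⟩
  · intro k hk j hj hkj
    obtain ⟨α, hα, hαk⟩ := h.2.1 k (Finset.mem_of_mem_erase hk)
    have hki := Finset.ne_of_mem_erase hk
    have hαi := h.eq_false (Finset.mem_of_mem_erase hk) hi hki hα hαk
    have hα' : CnfSat α (addUnit φ (k, true)) := cnfSat_addUnit.2 ⟨hαk, hα⟩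
    have hnot : ¬ Propagates (addUnit φ (k, true)) (i, true) := fun hp => by
      have := hp.litSat hα'
      simp [LitSat, hαi] at this
    have key : ∀ l, Propagates (addUnit φ (k, true)) l →
        l = (i, false) ∨ Propagates (addUnit (_root_.setFalse φ i) (k, true)) l := by
      intro l hl
      induction hl with
      | @intro C l hC hlC hp ih =>
        rcases Finset.mem_insert.1 hC with rfl | hCφ
        · rw [Finset.mem_singleton.1 hlC]
          exact .inr (.of_singleton (Finset.mem_insert_self _ _))
        · by_cases hneg : (i, false) ∈ C
          · left
            by_contra hne
            exact hnot (hp _ hneg (Ne.symm hne))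
          · right
            refine .intro (C := C.erase (i, true)) (Finset.mem_insert_of_mem ?_)
              (Finset.mem_erase.2 ⟨?_, hlC⟩) ?_
            · exact Finset.mem_image_of_mem _
                (Finset.mem_sdiff.2 ⟨hCφ, fun hh => hneg (mem_negOcc.1 hh).2⟩)
            · rintro rfl
              exact hnot (.intro hC hlC hp)
            · intro m hm hml
              obtain ⟨hm1, hm2⟩ := Finset.mem_erase.1 hm
              refine (ih m hm2 hml).resolve_left fun hh => hm1 ?_
              rw [← negLit_negLit m, hh]
              rfl
    refine (key _ (h.2.2 k (Finset.mem_of_mem_erase hk) j (Finset.mem_of_mem_erase hj)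
      hkj)).resolve_left fun hh => Finset.ne_of_mem_erase hj (congrArg Prod.fst hh)

lemma card_setFalse (φ : CNF V) (i : V) :
    (setFalse φ i).card + (negOcc φ i).card ≤ φ.card := by
  have h1 : (setFalse φ i).card ≤ (φ \ negOcc φ i).card := Finset.card_image_le
  have h2 : (φ \ negOcc φ i).card + (negOcc φ i).card = φ.card :=
    Finset.card_sdiff_add_card_eq_card (Finset.filter_subset _ _)
  omega

lemma card_negOcc_setFalse (φ : CNF V) (i j : V) :
    (negOcc (setFalse φ i) j).card ≤ (negOcc φ j \ negOcc φ i).card := by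
  refine le_trans (Finset.card_le_card ?_)
    (Finset.card_image_le (s := negOcc φ j \ negOcc φ i) (f := fun C => C.erase (i, true)))
  intro C hC
  obtain ⟨hC1, hC2⟩ := mem_negOcc.1 hC
  obtain ⟨D, hD, rfl⟩ := Finset.mem_image.1 hC1
  obtain ⟨hD1, hD2⟩ := Finset.mem_sdiff.1 hD
  exact Finset.mem_image_of_mem _
    (Finset.mem_sdiff.2 ⟨mem_negOcc.2 ⟨hD1, Finset.mem_of_mem_erase hC2⟩, hD2⟩)

/-- If `¬i` occurs only once, then some literal `g` next to it is equivalent to `i` in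
all models making an input true. -/
lemma IsPEnc.exists_equiv (h : IsPEnc φ I) (hI : 3 ≤ I.card) {i : V} (hi : i ∈ I)
    (hocc : (negOcc φ i).card ≤ 1) :
    ∃ C ∈ φ, (i, false) ∈ C ∧ ∃ g ∈ C, g.1 ∉ I ∧
      (∀ k ∈ I, ∀ α : V → Bool, CnfSat α φ → α k = true → (LitSat α g ↔ α i = true)) := by
  have huniq : ∀ C ∈ φ, ∀ D ∈ φ, (i, false) ∈ C → (i, false) ∈ D → D = C := fun C hC D hD h1 h2 =>
    Finset.card_le_one.1 hocc D (mem_negOcc.2 ⟨hD, h2⟩) C (mem_negOcc.2 ⟨hC, h1⟩)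
  by_cases hB : ∃ C ∈ φ, (i, false) ∈ C ∧ ∃ g ∈ C, g ≠ (i, false) ∧
      ∀ m ∈ C, m ≠ (i, false) → m ≠ g → Propagates φ (negLit m)
  · obtain ⟨C, hC, hiC, g, hgC, hgi, hg⟩ := hB
    have hig : ∀ α : V → Bool, CnfSat α φ → α i = true → LitSat α g := by
      intro α hα hαi
      obtain ⟨m, hm, hαm⟩ := hα C hC
      by_cases hmi : m = (i, false)
      · subst hmi
        simp [LitSat, hαi] at hαm
      · by_cases hmg : m = g
        · exact hmg ▸ hαm
        · exact absurd hαm (litSat_negLit.1 ((hg m hm hmi hmg).litSat hα))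
    have hgi' : ∀ α : V → Bool, CnfSat α φ → LitSat α g → ∀ k ∈ I, k ≠ i → α k = false := by
      intro α hα hαg k hk hki
      have key : ∀ l, Propagates (addUnit φ (i, true)) l → l = (i, true) ∨ LitSat α l := by
        intro l hl
        induction hl with
        | @intro D l hD hlD hp ih =>
          rcases Finset.mem_insert.1 hD with rfl | hDφ
          · exact .inl (Finset.mem_singleton.1 hlD)
          · by_cases hiD : (i, false) ∈ D
            · obtain rfl := huniq C hC D hDφ hiC hiD
              by_cases hgl : g = l
              · exact .inr (hgl ▸ hαg)
              · rcases ih g hgC hgl with hh | hh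
                · refine absurd ?_ hgi
                  rw [← negLit_negLit g, hh]
                  rfl
                · exact absurd hαg (litSat_negLit.1 hh)
            · right
              obtain ⟨m, hm, hαm⟩ := hα D hDφ
              by_cases hml : m = l
              · exact hml ▸ hαm
              · rcases ih m hm hml with hh | hh
                · refine absurd hm ?_
                  rw [← negLit_negLit m, hh]
                  exact hiD
                · exact absurd hαm (litSat_negLit.1 hh)
      rcases key _ (h.2.2 i hi k hk hki.symm) with hh | hh
      · simp at hh
      · exact hh
    refine ⟨C, hC, hiC, g, hgC, ?_, ?_⟩
    · intro hgI
      obtain ⟨v, b⟩ := g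
      by_cases hvi : v = i
      · subst hvi
        cases b
        · exact hgi rfl
        · exact h.1 C hC _ hgC hiC
      · cases b
        · have : 0 < ((I.erase i).erase v).card := by
            rw [Finset.card_erase_of_mem (Finset.mem_erase.2 ⟨hvi, hgI⟩),
              Finset.card_erase_of_mem hi]
            omega
          obtain ⟨j, hj⟩ := Finset.card_pos.1 this
          simp only [Finset.mem_erase] at hj
          obtain ⟨hjv, hji, hjI⟩ := hj
          obtain ⟨α, hα, hαj⟩ := h.2.1 j hjI
          have := hgi' α hα (h.eq_false hjI hgI hjv hα hαj) j hjI hji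
          simp [hαj] at this
        · obtain ⟨α, hα, hαi⟩ := h.2.1 i hi
          have h1 := h.eq_false hi hgI (Ne.symm hvi) hα hαi
          have h2 := hig α hα hαi
          simp [LitSat, h1] at h2
    · intro k hk α hα hαk
      refine ⟨fun hαg => ?_, hig α hα⟩
      by_cases hki : k = i
      · exact hki ▸ hαk
      · have := hgi' α hα hαg k hk hki
        simp [hαk] at this
  · exfalso
    push Not at hB
    have key : ∀ l, Propagates (addUnit φ (i, true)) l → l = (i, true) ∨ Propagates φ l := by
      intro l hl
      induction hl with
      | @intro D l hD hlD hp ih =>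
        rcases Finset.mem_insert.1 hD with rfl | hDφ
        · exact .inl (Finset.mem_singleton.1 hlD)
        · have ih' : ∀ m ∈ D, m ≠ l → m ≠ (i, false) → Propagates φ (negLit m) := by
            intro m hm hml hmi
            refine (ih m hm hml).resolve_left fun hh => hmi ?_
            rw [← negLit_negLit m, hh]
            rfl
          right
          by_cases hiD : (i, false) ∈ D
          · by_cases hli : l = (i, false)
            · exact .intro hDφ hlD fun m hm hml => ih' m hm hml (hli ▸ hml)
            · obtain ⟨m, hm, hmi, hml, hnot⟩ := hB D hDφ hiD l hlD hli
              exact absurd (ih' m hm hml hmi) hnot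
          · exact .intro hDφ hlD fun m hm hml => ih' m hm hml fun hh => hiD (hh ▸ hm)
    obtain ⟨j, hj, hji⟩ := Finset.exists_mem_ne (by omega : 1 < I.card) i
    obtain ⟨α, hα, hαj⟩ := h.2.1 j hj
    rcases key _ (h.2.2 i hi j hj hji.symm) with hh | hh
    · simp at hh
    · have := hh.litSat hα
      simp [LitSat, hαj] at this

lemma substLit_negLit (g₁ g₂ l : Lit V) :
    substLit g₁ g₂ (negLit l) = negLit (substLit g₁ g₂ l) := by
  obtain ⟨v, b⟩ := l
  obtain ⟨w, c⟩ := g₁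
  obtain ⟨u, d⟩ := g₂
  simp only [substLit, negLit]
  by_cases hv : v = w
  · cases b <;> cases c <;> simp [hv]
  · simp [hv]

lemma litSat_substLit {α : V → Bool} {g₁ g₂ : Lit V} (h : LitSat α g₁ ↔ LitSat α g₂)
    (l : Lit V) : LitSat α (substLit g₁ g₂ l) ↔ LitSat α l := by
  obtain ⟨v, b⟩ := l
  obtain ⟨w, c⟩ := g₁
  simp only [substLit]
  split_ifs with h1 h2
  · subst h1 h2
    exact h.symm
  · subst h1
    rw [litSat_negLit, ← h]
    unfold LitSat
    cases α v <;> cases b <;> cases c <;> simp_all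
  · rfl

/-- If `¬i` occurs only once, the encoding can be shortened. -/
lemma IsPEnc.exists_smaller (h : IsPEnc φ I) (hI : 3 ≤ I.card) {i : V} (hi : i ∈ I)
    (hocc : (negOcc φ i).card ≤ 1) : ∃ ψ : CNF V, IsPEnc ψ I ∧ ψ.card < φ.card := by
  obtain ⟨C, hC, hiC, g, hgC, hgI, hg⟩ := h.exists_equiv hI hi hocc
  set σ := substLit g (i, true) with hσ
  have hfix : ∀ v ∈ I, ∀ b, σ (v, b) = (v, b) := fun v hv b => by
    rw [hσ, substLit, if_neg]
    rintro rfl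
    exact hgI hv
  have hsat : ∀ k ∈ I, ∀ α : V → Bool, CnfSat α φ → α k = true →
      CnfSat α (substCNF g (i, true) φ) := by
    intro k hk α hα hαk D hD
    obtain ⟨E, hE, rfl⟩ := Finset.mem_image.1 (Finset.mem_filter.1 hD).1
    obtain ⟨l, hl, hαl⟩ := hα E hE
    exact ⟨σ l, Finset.mem_image_of_mem _ hl, (litSat_substLit (hg k hk α hα hαk) l).2 hαl⟩
  refine ⟨substCNF g (i, true) φ, ⟨?_, ?_, ?_⟩, ?_⟩
  · exact fun D hD => (Finset.mem_filter.1 hD).2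
  · intro k hk
    obtain ⟨α, hα, hαk⟩ := h.2.1 k hk
    exact ⟨α, hsat k hk α hα hαk, hαk⟩
  · intro k hk j hj hkj
    obtain ⟨α, hα, hαk⟩ := h.2.1 k hk
    rw [← hfix j hj]
    have hα' : CnfSat α (addUnit (substCNF g (i, true) φ) (k, true)) :=
      cnfSat_addUnit.2 ⟨hαk, hsat k hk α hα hαk⟩
    refine Propagates.map (substLit_negLit _ _) hα' ?_ (h.2.2 k hk j hj hkj)
    intro D hD hDc
    left
    rcases Finset.mem_insert.1 hD with rfl | hD
    · rw [Finset.image_singleton]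
      exact Finset.mem_insert.2 (.inl (congrArg _ (hfix k hk true)))
    · exact Finset.mem_insert_of_mem (Finset.mem_filter.2 ⟨Finset.mem_image_of_mem _ hD, hDc⟩)
  · refine lt_of_lt_of_le (Finset.card_lt_card ?_)
      (Finset.card_image_le (s := φ) (f := substClause g (i, true)))
    refine Finset.filter_ssubset.2 ⟨_, Finset.mem_image_of_mem _ hC, fun hcl => ?_⟩
    refine hcl (i, true) (Finset.mem_image.2 ⟨g, hgC, ?_⟩)
      (Finset.mem_image.2 ⟨_, hiC, hfix i hi false⟩)
    simp [substLit]

/-- The assignment `β` with the inputs replaced by the indicator of `J`. -/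
def withInputs (I J : Finset V) (β : V → Bool) (v : V) : Bool :=
  if v ∈ I then decide (v ∈ J) else β v

lemma litSat_withInputs_mono {J K : Finset V} (hJK : J ⊆ K) {β : V → Bool} {l : Lit V}
    (hl : LitSat (withInputs I J β) l) (hneg : ∀ v ∈ K, l ≠ (v, false)) :
    LitSat (withInputs I K β) l := by
  obtain ⟨v, b⟩ := l
  simp only [LitSat, withInputs] at hl ⊢
  split_ifs at hl ⊢ with hv
  · cases b
    · simpa using fun hvK => hneg v hvK rfl
    · simpa using hJK (by simpa using hl)
  · exact hl

lemma not_cnfSat_withInputs_pair (h : IsPEnc φ I) {i j : V} (hi : i ∈ I) (hj : j ∈ I)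
    (hij : i ≠ j) (β : V → Bool) : ¬ CnfSat (withInputs I {i, j} β) φ := fun hs => by
  have := h.eq_false hi hj hij hs (by simp [withInputs, hi])
  simp [withInputs, hj] at this

/-- The assignments whose completion by the `i`-th unit vector satisfies `φ`. -/
noncomputable def unitModels [Fintype V] (φ : CNF V) (I : Finset V) (i : V) :
    Finset (V → Bool) :=
  open Classical in Finset.univ.filter fun β => CnfSat (withInputs I {i} β) φ

lemma mem_unitModels [Fintype V] {i : V} {β : V → Bool} :
    β ∈ unitModels φ I i ↔ CnfSat (withInputs I {i} β) φ := by
  simp [unitModels]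

lemma disjoint_unitModels [Fintype V] (h : IsPEnc φ I)
    (hdisj : ∀ i ∈ I, ∀ j ∈ I, i ≠ j → ∀ C ∈ φ, (i, false) ∈ C → (j, false) ∉ C)
    {i j : V} (hi : i ∈ I) (hj : j ∈ I) (hij : i ≠ j) :
    Disjoint (unitModels φ I i) (unitModels φ I j) := by
  refine Finset.disjoint_left.2 fun β hβi hβj => not_cnfSat_withInputs_pair h hi hj hij β ?_
  rw [mem_unitModels] at hβi hβj
  intro C hC
  by_cases hiC : (i, false) ∈ C
  · have hjC := hdisj i hi j hj hij C hC hiC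
    obtain ⟨l, hl, hs⟩ := hβi C hC
    refine ⟨l, hl, litSat_withInputs_mono (by simp) hs fun v hv hlv => ?_⟩
    subst hlv
    rcases Finset.mem_insert.1 hv with rfl | hv
    · simp [LitSat, withInputs, hi] at hs
    · exact hjC (Finset.mem_singleton.1 hv ▸ hl)
  · obtain ⟨l, hl, hs⟩ := hβj C hC
    refine ⟨l, hl, litSat_withInputs_mono (by simp) hs fun v hv hlv => ?_⟩
    subst hlv
    rcases Finset.mem_insert.1 hv with rfl | hv
    · exact hiC hl
    · rw [Finset.mem_singleton.1 hv] at hs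
      simp [LitSat, withInputs, hj] at hs

lemma card_agree [Fintype V] (α : V → Bool) (T : Finset V) :
    2 ^ Fintype.card V ≤
      2 ^ T.card * (Finset.univ.filter fun β : V → Bool => ∀ v ∈ T, β v = α v).card := by
  have hmaps : Fintype.card (V → Bool) ≤
      ((Finset.univ : Finset (T → Bool)) ×ˢ
        (Finset.univ.filter fun β : V → Bool => ∀ v ∈ T, β v = α v)).card := by
    rw [← Finset.card_univ]
    refine Finset.card_le_card_of_injOn
      (fun β => (fun v => β v, fun v => if v ∈ T then α v else β v)) ?_ ?_
    · intro β _
      simp +contextual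
    · intro β _ γ _ hβγ
      obtain ⟨h1, h2⟩ := Prod.mk.inj hβγ
      funext v
      by_cases hv : v ∈ T
      · exact congrFun h1 ⟨v, hv⟩
      · simpa [hv] using congrFun h2 v
  simpa [Finset.card_product] using hmaps

/-- The clauses without negated inputs. -/
def restClauses (φ : CNF V) (I : Finset V) : CNF V :=
  φ.filter fun C => ∀ i ∈ I, (i, false) ∉ C

lemma mem_restClauses {C : Clause V} :
    C ∈ restClauses φ I ↔ C ∈ φ ∧ ∀ i ∈ I, (i, false) ∉ C := by
  simp [restClauses]

lemma card_unitModels [Fintype V] (h : IsPEnc φ I) {i : V} (hi : i ∈ I) :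
    2 ^ Fintype.card V ≤
      2 ^ (negOcc φ i ∪ (restClauses φ I).filter fun C => (i, true) ∉ C).card *
        (unitModels φ I i).card := by
  obtain ⟨α, hα, hαi⟩ := h.2.1 i hi
  have : Nonempty (Lit V) := ⟨(i, true)⟩
  choose! f hf hfα using id hα
  set Z := negOcc φ i ∪ (restClauses φ I).filter fun C => (i, true) ∉ C with hZ
  refine (card_agree α (Z.image fun C => (f C).1)).trans
    (Nat.mul_le_mul (Nat.pow_le_pow_right two_pos Finset.card_image_le) (Finset.card_le_card ?_))
  intro β hβ
  have hβ' : ∀ C ∈ Z, β (f C).1 = α (f C).1 := fun C hC =>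
    (Finset.mem_filter.1 hβ).2 _ (Finset.mem_image_of_mem _ hC)
  rw [mem_unitModels]
  intro C hC
  by_cases hCZ : C ∈ Z
  · refine ⟨f C, hf C hC, ?_⟩
    have hs := hfα C hC
    unfold LitSat at hs ⊢
    rw [← hs, withInputs]
    split_ifs with hv
    · by_cases hvi : (f C).1 = i
      · simp [hvi, hαi]
      · rw [h.eq_false hi hv (Ne.symm hvi) hα hαi]
        simpa using hvi
    · exact hβ' C hCZ
  · simp only [hZ, Finset.mem_union, mem_negOcc, Finset.mem_filter, mem_restClauses, not_or,
      not_and, not_not, hC, true_and] at hCZ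
    by_cases hex : ∃ k ∈ I, (k, false) ∈ C
    · obtain ⟨k, hk, hkC⟩ := hex
      refine ⟨_, hkC, ?_⟩
      have : k ≠ i := fun hki => hCZ.1 (hki ▸ hkC)
      simp [LitSat, withInputs, hk, this]
    · push Not at hex
      exact ⟨_, hCZ.2 hex, by simp [LitSat, withInputs, hi]⟩

lemma exists_not_clauseSat {C : Clause V} (hC : IsClause C) : ∃ β : V → Bool, ¬ ClauseSat β C := by
  refine ⟨fun v => decide ((v, false) ∈ C), ?_⟩
  rintro ⟨⟨v, b⟩, hl, hs⟩
  cases b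
  · simp [LitSat, hl] at hs
  · exact hC _ hl (of_decide_eq_true hs)

lemma card_bound_of_disjoint [Fintype V] (h : IsPEnc φ I) (h8 : I.card ≤ 8)
    (hocc : ∀ i ∈ I, (negOcc φ i).card = 2)
    (hdisj : ∀ i ∈ I, ∀ j ∈ I, i ≠ j → ∀ C ∈ φ, (i, false) ∈ C → (j, false) ∉ C) :
    3 * I.card - 6 ≤ φ.card := by
  have hcard : 2 * I.card + (restClauses φ I).card ≤ φ.card := by
    have h1 : (I.biUnion (negOcc φ)).card = 2 * I.card := by
      rw [Finset.card_biUnion, Finset.sum_congr rfl hocc]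
      · simp [mul_comm]
      · intro i hi j hj hij
        refine Finset.disjoint_left.2 fun C hCi hCj => ?_
        rw [mem_negOcc] at hCi hCj
        exact hdisj i hi j hj hij C hCi.1 hCi.2 hCj.2
    rw [← h1, ← Finset.card_union_of_disjoint]
    · refine Finset.card_le_card (Finset.union_subset (Finset.biUnion_subset.2 fun i _ =>
        Finset.filter_subset _ _) fun C hC => (mem_restClauses.1 hC).1)
    · refine Finset.disjoint_left.2 fun C hC hC' => ?_
      obtain ⟨i, hi, hCi⟩ := Finset.mem_biUnion.1 hC
      exact (mem_restClauses.1 hC').2 i hi (mem_negOcc.1 hCi).2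
  set N := 2 ^ Fintype.card V with hN
  have hNpos : 0 < N := by positivity
  set U := I.biUnion (unitModels φ I) with hU
  have hUcard : U.card = ∑ i ∈ I, (unitModels φ I i).card :=
    Finset.card_biUnion fun i hi j hj hij => disjoint_unitModels h hdisj hi hj hij
  have hUN : U.card ≤ N := by
    simpa [hN] using Finset.card_le_univ U
  have hlow : ∀ i ∈ I, ∀ r,
      ((restClauses φ I).filter fun C => (i, true) ∉ C).card ≤ r →
      N ≤ 2 ^ (2 + r) * (unitModels φ I i).card := by
    intro i hi r hr
    refine (card_unitModels h hi).trans (Nat.mul_le_mul_right _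
      (Nat.pow_le_pow_right two_pos ((Finset.card_union_le _ _).trans ?_)))
    rw [hocc i hi]
    omega
  by_contra hlt
  have hrest : (restClauses φ I).card ≤ 1 := by omega
  rcases Nat.le_one_iff_eq_zero_or_eq_one.1 hrest with h0 | h1
  · have hsum : I.card * N ≤ 4 * U.card := by
      rw [hUcard, Finset.mul_sum, ← smul_eq_mul]
      refine Finset.card_nsmul_le_sum _ _ _ fun i hi => ?_
      exact hlow i hi 0 ((Finset.card_filter_le _ _).trans h0.le)
    have : 7 * N ≤ I.card * N := Nat.mul_le_mul_right _ (by omega)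
    omega
  · have hI8 : I.card = 8 := by omega
    have hlow8 : ∀ i ∈ I, N ≤ 8 * (unitModels φ I i).card := fun i hi =>
      hlow i hi 1 ((Finset.card_filter_le _ _).trans h1.le)
    obtain ⟨D, hD⟩ := Finset.card_eq_one.1 h1
    have hDφ : D ∈ restClauses φ I := by simp [hD]
    by_cases hpos : ∃ j ∈ I, (j, true) ∈ D
    · obtain ⟨j, hj, hjD⟩ := hpos
      have hj4 : N ≤ 4 * (unitModels φ I j).card := by
        refine hlow j hj 0 ?_
        simp [hD, Finset.filter_singleton, hjD]
      have hsum : 7 * N ≤ 8 * ∑ i ∈ I.erase j, (unitModels φ I i).card := by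
        have h7 : (I.erase j).card = 7 := by rw [Finset.card_erase_of_mem hj, hI8]
        rw [Finset.mul_sum, ← h7, ← smul_eq_mul]
        exact Finset.card_nsmul_le_sum _ _ _ fun i hi => hlow8 i (Finset.mem_of_mem_erase hi)
      rw [← Finset.add_sum_erase _ _ hj] at hUcard
      omega
    · push Not at hpos
      have hDmem := mem_restClauses.1 hDφ
      obtain ⟨β, hβ⟩ := exists_not_clauseSat (h.1 D hDmem.1)
      have hβU : β ∉ U := by
        intro hβU
        obtain ⟨i, hi, hβi⟩ := Finset.mem_biUnion.1 hβU
        obtain ⟨⟨v, b⟩, hl, hs⟩ := mem_unitModels.1 hβi D hDmem.1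
        refine hβ ⟨_, hl, ?_⟩
        have hv : v ∉ I := fun hv => by
          cases b
          · exact hDmem.2 v hv hl
          · exact hpos v hv hl
        simpa [LitSat, withInputs, hv] using hs
      have hlt' : U.card < N := by
        have := Finset.card_lt_univ_of_notMem hβU
        simpa [hN] using this
      have hsum : I.card * N ≤ 8 * U.card := by
        rw [hUcard, Finset.mul_sum, ← smul_eq_mul]
        exact Finset.card_nsmul_le_sum _ _ _ hlow8
      rw [hI8] at hsum
      omega

lemma IsPEnc.three_le_card (h : IsPEnc φ I) (hI : I.card = 3)
    (hocc : ∀ i ∈ I, 2 ≤ (negOcc φ i).card) : 3 ≤ φ.card := by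
  by_contra hlt
  have hall : ∀ i ∈ I, negOcc φ i = φ := fun i hi =>
    Finset.eq_of_subset_of_card_le (Finset.filter_subset _ _) (by have := hocc i hi; omega)
  obtain ⟨a, b, c, hab, hac, hbc, rfl⟩ := Finset.card_eq_three.1 hI
  refine not_cnfSat_withInputs_pair h (i := a) (j := b) (by simp) (by simp) hab
    (fun _ => false) fun C hC => ⟨(c, false), ?_, ?_⟩
  · rw [← hall c (by simp)] at hC
    exact (mem_negOcc.1 hC).2
  · simp [LitSat, withInputs, hac.symm, hbc.symm]

theorem IsPEnc.card_bound [Fintype V] (h : IsPEnc φ I) (h3 : 3 ≤ I.card) (h8 : I.card ≤ 8) :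
    3 * I.card - 6 ≤ φ.card := by
  induction hn : φ.card using Nat.strong_induction_on generalizing φ I with
  | _ n ih =>
    subst hn
    by_cases hone : ∃ i ∈ I, (negOcc φ i).card ≤ 1
    · obtain ⟨i, hi, hocc⟩ := hone
      obtain ⟨ψ, hψ, hlt⟩ := h.exists_smaller h3 hi hocc
      exact (ih _ hlt hψ h3 h8 rfl).trans hlt.le
    push Not at hone
    rcases h3.eq_or_lt with h3' | h4
    · have := h.three_le_card h3'.symm hone
      omega
    have herase : ∀ i ∈ I, (I.erase i).card = I.card - 1 := fun i hi =>
      Finset.card_erase_of_mem hi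
    by_cases hthree : ∃ i ∈ I, 3 ≤ (negOcc φ i).card
    · obtain ⟨i, hi, hocc⟩ := hthree
      have hcs := card_setFalse φ i
      have := ih _ (by omega) (h.setFalse hi) (by rw [herase i hi]; omega)
        (by rw [herase i hi]; omega) rfl
      rw [herase i hi] at this
      omega
    push Not at hthree
    have hocc : ∀ i ∈ I, (negOcc φ i).card = 2 := fun i hi => by
      have := hone i hi
      have := hthree i hi
      omega
    by_cases hshared : ∃ i ∈ I, ∃ j ∈ I, i ≠ j ∧ ∃ C ∈ φ, (i, false) ∈ C ∧ (j, false) ∈ C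
    · obtain ⟨i, hi, j, hj, hij, C, hC, hCi, hCj⟩ := hshared
      have hj1 : (negOcc (_root_.setFalse φ i) j).card ≤ 1 := by
        refine (card_negOcc_setFalse φ i j).trans ?_
        have : (negOcc φ j \ negOcc φ i).card < (negOcc φ j).card := by
          refine Finset.card_lt_card (Finset.ssubset_iff_of_subset Finset.sdiff_subset |>.2
            ⟨C, mem_negOcc.2 ⟨hC, hCj⟩, fun hh => (Finset.mem_sdiff.1 hh).2
              (mem_negOcc.2 ⟨hC, hCi⟩)⟩)
        have := hocc j hj
        omega
      have hI' := herase i hi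
      obtain ⟨ψ, hψ, hlt⟩ := (h.setFalse hi).exists_smaller (by omega)
        (Finset.mem_erase.2 ⟨hij.symm, hj⟩) hj1
      have hcs := card_setFalse φ i
      have := ih _ (by omega) hψ (by omega) (by omega) rfl
      have := hocc i hi
      omega
    · push Not at hshared
      exact card_bound_of_disjoint h h8 hocc hshared

end Bounds

lemma isPEncoding_iff {n ℓ : ℕ} {φ : CNF (Var n ℓ)} :
    IsPEncoding φ ↔ IsPEnc φ (Finset.univ.image Sum.inl) := by
  simp only [IsPEncoding, IsPEnc, Finset.mem_image, Finset.mem_univ, true_and,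
    forall_exists_index, forall_apply_eq_imp_iff, inLit, ne_eq, Sum.inl.injEq]
  exact and_congr_right fun _ => and_congr_right fun _ => forall_congr' fun i =>
    forall_congr' fun j => imp_congr_right fun _ =>
      ⟨UnitDerives.propagates, Propagates.unitDerives⟩

section Construction

variable {V W : Type} [DecidableEq W]

/-- Replacing the input `i` of an encoding by two new inputs `a` and `b`, along `f`. -/
def splitInput (φ : CNF V) (f : V ↪ W) (i : V) (a b : W) : CNF W :=
  φ.image (fun C => C.image (Prod.map f id)) ∪
    {{(a, false), (f i, true)}, {(b, false), (f i, true)}, {(a, false), (b, false)}}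

lemma card_splitInput (φ : CNF V) (f : V ↪ W) (i : V) (a b : W) :
    (splitInput φ f i a b).card ≤ φ.card + 3 :=
  (Finset.card_union_le _ _).trans (Nat.add_le_add Finset.card_image_le Finset.card_le_three)

lemma IsPEnc.splitInput [DecidableEq V] {φ : CNF V} {I : Finset V} (h : IsPEnc φ I)
    (f : V ↪ W) {i : V}
    (hi : i ∈ I) {a b : W} (ha : a ∉ Set.range f) (hb : b ∉ Set.range f) (hab : a ≠ b) :
    IsPEnc (splitInput φ f i a b) (insert a (insert b ((I.erase i).map f))) := by
  set ψ := _root_.splitInput φ f i a b with hψ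
  have hca : {(a, false), (f i, true)} ∈ ψ := by simp [hψ, _root_.splitInput]
  have hcb : {(b, false), (f i, true)} ∈ ψ := by simp [hψ, _root_.splitInput]
  have hcab : {(a, false), (b, false)} ∈ ψ := by simp [hψ, _root_.splitInput]
  have hfa : ∀ v, f v ≠ a := fun v hv => ha ⟨v, hv⟩
  have hfb : ∀ v, f v ≠ b := fun v hv => hb ⟨v, hv⟩
  have hψmem : ∀ C ∈ ψ, (∃ D ∈ φ, D.image (Prod.map f id) = C) ∨
      C = {(a, false), (f i, true)} ∨ C = {(b, false), (f i, true)} ∨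
      C = {(a, false), (b, false)} := by
    intro C hC
    simpa only [hψ, _root_.splitInput, Finset.mem_union, Finset.mem_image, Finset.mem_insert,
      Finset.mem_singleton] using hC
  have hsat : ∀ (α : V → Bool) (c : W → Bool), CnfSat α φ → (c a = true → α i = true) →
      (c b = true → α i = true) → (c a = true → c b = false) →
      CnfSat (Function.extend f α c) ψ := by
    intro α c hα h1 h2 h3 C hC
    have hea : Function.extend f α c a = c a := Function.extend_apply' _ _ _ ha
    have heb : Function.extend f α c b = c b := Function.extend_apply' _ _ _ hb
    have hef : ∀ v, Function.extend f α c (f v) = α v := f.injective.extend_apply _ _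
    rcases hψmem C hC with ⟨D, hD, rfl⟩ | rfl | rfl | rfl
    · obtain ⟨l, hl, hs⟩ := hα D hD
      exact ⟨_, Finset.mem_image_of_mem _ hl, (hef _).trans hs⟩
    all_goals
      simp only [ClauseSat, LitSat, Finset.mem_insert, Finset.mem_singleton, exists_eq_or_imp,
        exists_eq_left, hea, heb, hef]
      cases hca' : c a <;> cases hcb' : c b <;> simp_all
  have hsat' : ∀ k ∈ insert a (insert b ((I.erase i).map f)),
      ∃ β : W → Bool, CnfSat β ψ ∧ β k = true := by
    intro k hk
    simp only [Finset.mem_insert, Finset.mem_map] at hk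
    rcases hk with rfl | rfl | ⟨v, hv, rfl⟩
    · obtain ⟨α, hα, hαi⟩ := h.2.1 i hi
      refine ⟨_, hsat α (fun w => decide (w = k)) hα ?_ ?_ ?_, ?_⟩
      · simp [hαi]
      · simp [hαi]
      · simpa using hab.symm
      · rw [Function.extend_apply' _ _ _ ha]
        simp
    · obtain ⟨α, hα, hαi⟩ := h.2.1 i hi
      refine ⟨_, hsat α (fun w => decide (w = k)) hα ?_ ?_ ?_, ?_⟩
      · simp [hαi]
      · simp [hαi]
      · simp [hab]
      · rw [Function.extend_apply' _ _ _ hb]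
        simp
    · obtain ⟨α, hα, hαv⟩ := h.2.1 v (Finset.mem_of_mem_erase hv)
      refine ⟨_, hsat α (fun _ => false) hα ?_ ?_ ?_, ?_⟩
      · simp
      · simp
      · simp
      · rw [f.injective.extend_apply, hαv]
  have hmap : ∀ (u : W) (β : W → Bool), CnfSat β (addUnit ψ (u, true)) → ∀ k ∈ I, ∀ j ∈ I,
      k ≠ j → Propagates (addUnit ψ (u, true)) (f k, true) →
      Propagates (addUnit ψ (u, true)) (f j, false) := by
    intro u β hβ k hk j hj hkj hp
    refine Propagates.map (σ := Prod.map f id) (fun l => rfl) hβ ?_ (h.2.2 k hk j hj hkj)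
    intro C hC _
    rcases Finset.mem_insert.1 hC with rfl | hC
    · exact .inr ⟨_, rfl, hp⟩
    · exact .inl (Finset.mem_insert_of_mem (Finset.mem_union_left _
        (Finset.mem_image_of_mem _ hC)))
  have hself : ∀ u : W, Propagates (addUnit ψ (u, true)) (u, true) := fun u =>
    .of_singleton (Finset.mem_insert_self _ _)
  have hmem : ∀ {u : W} {C}, C ∈ ψ → C ∈ addUnit ψ (u, true) := Finset.mem_insert_of_mem
  refine ⟨?_, hsat', ?_⟩
  · intro C hC
    rcases hψmem C hC with ⟨D, hD, rfl⟩ | rfl | rfl | rfl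
    · intro l hl hl'
      obtain ⟨x, hx, rfl⟩ := Finset.mem_image.1 hl
      obtain ⟨y, hy, hxy⟩ := Finset.mem_image.1 hl'
      have : y = negLit x :=
        Prod.ext (f.injective (Prod.ext_iff.1 hxy).1) (Prod.ext_iff.1 hxy).2
      exact h.1 D hD x hx (this ▸ hy)
    all_goals simp [IsClause, negLit, hfa, hfb, (hfa _).symm, (hfb _).symm]
  · intro k hk j hj hkj
    obtain ⟨β, hβ, hβk⟩ := hsat' k hk
    have hβ' : CnfSat β (addUnit ψ (k, true)) := cnfSat_addUnit.2 ⟨hβk, hβ⟩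
    simp only [Finset.mem_insert, Finset.mem_map, Finset.mem_erase] at hk hj
    have htop : ∀ v, v ≠ i ∧ v ∈ I → Propagates (addUnit ψ (k, true)) (f i, true) →
        Propagates (addUnit ψ (k, true)) (f v, false) := fun v hv hp =>
      hmap k β hβ' i hi v hv.2 hv.1.symm hp
    rcases hk with rfl | rfl | ⟨v, hv, rfl⟩
    · have hp : Propagates (addUnit ψ (k, true)) (f i, true) := .of_pair (hmem hca) (hself k)
      rcases hj with rfl | rfl | ⟨w, hw, rfl⟩
      · exact absurd rfl hkj
      · exact .of_pair (hmem hcab) (hself k)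
      · exact htop w hw hp
    · have hp : Propagates (addUnit ψ (k, true)) (f i, true) := .of_pair (hmem hcb) (hself k)
      rcases hj with rfl | rfl | ⟨w, hw, rfl⟩
      · rw [Finset.pair_comm] at hcab
        exact .of_pair (hmem hcab) (hself k)
      · exact absurd rfl hkj
      · exact htop w hw hp
    · have hp : ∀ w ∈ I, v ≠ w → Propagates (addUnit ψ (f v, true)) (f w, false) :=
        fun w hw hvw => hmap _ β hβ' v hv.2 w hw hvw (hself _)
      rw [Finset.pair_comm] at hca hcb
      rcases hj with rfl | rfl | ⟨w, hw, rfl⟩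
      · exact .of_pair (hmem hca) (hp i hi hv.1)
      · exact .of_pair (hmem hcb) (hp i hi hv.1)
      · exact hp w hw.2 fun hvw => hkj (hvw ▸ rfl)

/-- The embedding of variables turning the last input into a new auxiliary variable. -/
def hideLast (n ℓ : ℕ) : Var (n + 1) ℓ ↪ Var (n + 2) (ℓ + 1) where
  toFun := Sum.elim
    (fun i => if h : i.1 < n then Sum.inl ⟨i, by omega⟩ else Sum.inr (Fin.last ℓ))
    (fun j => Sum.inr j.castSucc)
  inj' := by
    rintro (i | i) (j | j) hij
    · simp only [Sum.elim_inl] at hij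
      congr 1
      ext
      split_ifs at hij <;> simp_all
      omega
    · simp only [Sum.elim_inl, Sum.elim_inr] at hij
      split_ifs at hij
      exact absurd (Sum.inr.inj hij) (Fin.castSucc_lt_last j).ne'
    · simp only [Sum.elim_inl, Sum.elim_inr] at hij
      split_ifs at hij
      exact absurd (Sum.inr.inj hij) (Fin.castSucc_lt_last i).ne
    · simpa using hij

lemma hideLast_inl (n ℓ : ℕ) (i : Fin (n + 1)) : hideLast n ℓ (Sum.inl i) =
    if h : i.1 < n then Sum.inl ⟨i, by omega⟩ else Sum.inr (Fin.last ℓ) := rfl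

lemma hideLast_inr (n ℓ : ℕ) (j : Fin ℓ) : hideLast n ℓ (Sum.inr j) = Sum.inr j.castSucc := rfl

lemma exists_pencoding_succ {n ℓ : ℕ} {φ : CNF (Var (n + 1) ℓ)} (h : IsPEncoding φ) :
    ∃ ψ : CNF (Var (n + 2) (ℓ + 1)), IsPEncoding ψ ∧ ψ.card ≤ φ.card + 3 := by
  rw [isPEncoding_iff] at h
  have hrange : ∀ v, ∀ k : Fin (n + 2), hideLast n ℓ v = Sum.inl k → k.1 < n := by
    rintro (i | j) k hk
    · rw [hideLast_inl] at hk
      split_ifs at hk with hin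
      rw [← Sum.inl.inj hk]
      exact hin
    · simp [hideLast_inr] at hk
  have hs := h.splitInput (hideLast n ℓ) (i := Sum.inl (Fin.last n)) (by simp)
    (a := Sum.inl ⟨n, by omega⟩) (b := Sum.inl ⟨n + 1, by omega⟩)
    (by rintro ⟨v, hv⟩; have := hrange v _ hv; simp at this)
    (by rintro ⟨v, hv⟩; have := hrange v _ hv; simp at this) (by simp)
  refine ⟨_, isPEncoding_iff.2 ?_, card_splitInput φ (hideLast n ℓ) (Sum.inl (Fin.last n))
    (Sum.inl ⟨n, by omega⟩) (Sum.inl ⟨n + 1, by omega⟩)⟩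
  convert hs using 1
  ext v
  simp only [Finset.mem_image, Finset.mem_univ, true_and, Finset.mem_insert, Finset.mem_map,
    Finset.mem_erase]
  constructor
  · rintro ⟨k, rfl⟩
    by_cases hk : k.1 < n
    · refine .inr (.inr ⟨Sum.inl ⟨k, by omega⟩, ⟨?_, _, rfl⟩, ?_⟩)
      · simpa [Fin.ext_iff] using hk.ne
      · simp [hideLast_inl, hk]
    · by_cases hkn : k.1 = n
      · exact .inl (congrArg Sum.inl (Fin.ext hkn))
      · exact .inr (.inl (congrArg Sum.inl (Fin.ext (by simp only; omega))))
  · rintro (rfl | rfl | ⟨_, ⟨hne, k, rfl⟩, rfl⟩)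
    · exact ⟨_, rfl⟩
    · exact ⟨_, rfl⟩
    · have hk : k.1 < n := by
        have : k ≠ Fin.last n := fun hk => hne (hk ▸ rfl)
        exact Fin.val_lt_last this
      exact ⟨⟨k, by omega⟩, by simp [hideLast_inl, hk]⟩

lemma exists_pencoding_three : ∃ φ : CNF (Var 3 0), IsPEncoding φ ∧ φ.card ≤ 3 := by
  refine ⟨{{inLit 0 false, inLit 1 false}, {inLit 0 false, inLit 2 false},
    {inLit 1 false, inLit 2 false}}, ⟨?_, ?_, ?_⟩, Finset.card_le_three⟩
  · simp [IsCNF, IsClause, inLit, negLit]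
  · intro i
    refine ⟨Sum.elim (fun j => decide (j = i)) fun _ => false, ?_, by simp⟩
    fin_cases i <;> simp [CnfSat, ClauseSat, LitSat, inLit] <;> decide
  · intro i j hij
    refine (Propagates.of_pair (a := inLit i false) ?_
      (.of_singleton (Finset.mem_insert_self _ _))).unitDerives
    refine Finset.mem_insert_of_mem ?_
    fin_cases i <;> fin_cases j <;> first | exact absurd rfl hij | decide

lemma exists_pencoding (m : ℕ) :
    ∃ (ℓ : ℕ) (φ : CNF (Var (m + 3) ℓ)), IsPEncoding φ ∧ φ.card ≤ 3 * m + 3 := by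
  induction m with
  | zero => exact ⟨0, exists_pencoding_three⟩
  | succ m ih =>
    obtain ⟨ℓ, φ, hφ, hcard⟩ := ih
    obtain ⟨ψ, hψ, hcard'⟩ := exists_pencoding_succ hφ
    exact ⟨ℓ + 1, ψ, hψ, by omega⟩

end Construction

/-- For every n with 3 ≤ n ≤ 8, the minimum size S(n) of a p-encoding
with n input variables equals 3n − 6. -/
theorem penc_min_size_small (n : ℕ) (h3 : 3 ≤ n) (h8 : n ≤ 8) :
    S n = 3 * n - 6 := by
  obtain ⟨m, rfl⟩ := Nat.exists_eq_add_of_le' h3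
  obtain ⟨ℓ, φ, hφ, hcard⟩ := exists_pencoding m
  have hmem : φ.card ∈ pencSizes (m + 3) := ⟨ℓ, φ, hφ, rfl⟩
  refine le_antisymm ((Nat.sInf_le hmem).trans (by omega)) ?_
  obtain ⟨ℓ', ψ, hψ, hψcard⟩ := Nat.sInf_mem ⟨_, hmem⟩
  have hI : ((Finset.univ : Finset (Fin (m + 3))).image (Sum.inl : _ → Var (m + 3) ℓ')).card =
      m + 3 := by
    rw [Finset.card_image_of_injective _ Sum.inl_injective, Finset.card_univ, Fintype.card_fin]
  have := (isPEncoding_iff.1 hψ).card_bound (by omega) (by omega)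
  rw [hI, hψcard] at this
  exact this
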